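/- The function q is twice continuously differentiable on [0,∞), and its second derivative satisfies q''(r) ≤ 0 and |q''(r)| ≤ 5α𝓡/4 + 4/𝓡 for every r ≥ 0. -/

import Mathlib

open MeasureTheory Real

/-- The concave reweighting function τ from the Eberle-type construction. -/
noncomputable def tau (R r : ℝ) : ℝ :=
  if r ≤ R then r ^ 2 / 2
  else if r ≤ 2 * R then
    R ^ 2 / 2 + R * (r - R) + (r - R) ^ 2 / 2 - (r - R) ^ 3 / (3 * R)
  else if r ≤ 4 * R then
    5 * R ^ 2 / 3 + R * (r - 2 * R) - (r - 2 * R) ^ 2 / 2 + (r - 2 * R) ^ 3 / (12 * R)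
  else 7 * R ^ 2 / 3

/-- The cutoff function μ. -/
noncomputable def muf (R r : ℝ) : ℝ :=
  if r ≤ R then 1
  else if r ≤ 4 * R then 1 / 2 + 1 / 2 * Real.cos (Real.pi * (r - R) / (3 * R))
  else 0

/-- ψ(r) = exp(−α τ(r)). -/
noncomputable def psi (α R r : ℝ) : ℝ := Real.exp (-(α * tau R r))

/-- Ψ(r) = ∫₀ʳ ψ(s) ds. -/
noncomputable def PsiInt (α R r : ℝ) : ℝ := ∫ s in (0:ℝ)..r, psi α R s

/-- ν(r) = 1 − (1/2) (∫₀ʳ μΨ/ψ) / (∫₀^{4R} μΨ/ψ). -/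
noncomputable def nuf (α R r : ℝ) : ℝ :=
  1 - (1 / 2) * (∫ s in (0:ℝ)..r, muf R s * PsiInt α R s / psi α R s) /
      (∫ s in (0:ℝ)..(4 * R), muf R s * PsiInt α R s / psi α R s)

/-- q(r) = ∫₀ʳ ψ(s) ν(s) ds. -/
noncomputable def qf (α R r : ℝ) : ℝ := ∫ s in (0:ℝ)..r, psi α R s * nuf α R s

lemma hasDerivAt_glue {f g f' g' : ℝ → ℝ} {c : ℝ} (hf : ∀ x, HasDerivAt f (f' x) x)
    (hg : ∀ x, HasDerivAt g (g' x) x) (h0 : f c = g c) (h1 : f' c = g' c) (x : ℝ) :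
    HasDerivAt (fun y => if y ≤ c then f y else g y) (if x ≤ c then f' x else g' x) x := by
  rcases lt_trichotomy x c with h | h | h
  · rw [if_pos h.le]
    refine (hf x).congr_of_eventuallyEq ?_
    filter_upwards [Iio_mem_nhds h] with y hy
    exact if_pos (le_of_lt hy)
  · subst h
    rw [if_pos le_rfl]
    have hl : HasDerivWithinAt (fun y => if y ≤ x then f y else g y) (f' x) (Set.Iic x) x := by
      refine (hf x).hasDerivWithinAt.congr (fun y hy => if_pos hy) (if_pos le_rfl)
    have hr : HasDerivWithinAt (fun y => if y ≤ x then f y else g y) (f' x) (Set.Ici x) x := by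
      rw [h1]
      refine (hg x).hasDerivWithinAt.congr (fun y hy => ?_) ?_
      · rcases eq_or_lt_of_le (Set.mem_Ici.1 hy) with e | e
        · subst e; simp [h0]
        · exact if_neg (not_le.2 e)
      · simp [h0]
    have := hl.union hr
    rwa [Set.Iic_union_Ici, hasDerivWithinAt_univ] at this
  · rw [if_neg (not_le.2 h)]
    refine (hg x).congr_of_eventuallyEq ?_
    filter_upwards [Ioi_mem_nhds h] with y hy
    exact if_neg (not_le.2 hy)

/-- The derivative of τ. -/
noncomputable def dtau (R r : ℝ) : ℝ :=
  if r ≤ R then r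
  else if r ≤ 2 * R then R + (r - R) - (r - R) ^ 2 / R
  else if r ≤ 4 * R then R - (r - 2 * R) + (r - 2 * R) ^ 2 / (4 * R)
  else 0

lemma hasDerivAt_tau {R : ℝ} (hR : 0 < R) (r : ℝ) : HasDerivAt (tau R) (dtau R r) r := by
  have hp : ∀ (a b c d e : ℝ) (x : ℝ), HasDerivAt
      (fun y : ℝ => a + b * (y - e) + c * (y - e) ^ 2 + d * (y - e) ^ 3)
      (b + c * (2 * (x - e)) + d * (3 * (x - e) ^ 2)) x := by
    intro a b c d e x
    have h := (hasDerivAt_id x).sub_const e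
    have := (((h.const_mul b).const_add a).add ((h.pow 2).const_mul c)).add
      ((h.pow 3).const_mul d)
    refine HasDerivAt.congr_deriv (f := fun y : ℝ =>
      a + b * (y - e) + c * (y - e) ^ 2 + d * (y - e) ^ 3) this ?_
    simp
  refine hasDerivAt_glue (c := R) (f := fun r => r ^ 2 / 2) (f' := fun r => r)
    (g' := fun r => if r ≤ 2 * R then R + (r - R) - (r - R) ^ 2 / R
      else if r ≤ 4 * R then R - (r - 2 * R) + (r - 2 * R) ^ 2 / (4 * R) else 0) ?_ ?_ ?_ ?_ r
  · intro x
    convert hp 0 0 (1/2) 0 0 x using 1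
    · ext y; ring
    · ring
  · refine hasDerivAt_glue (c := 2 * R)
      (f' := fun r => R + (r - R) - (r - R) ^ 2 / R)
      (g' := fun r => if r ≤ 4 * R then R - (r - 2 * R) + (r - 2 * R) ^ 2 / (4 * R) else 0)
      ?_ ?_ ?_ ?_
    · intro x
      convert hp (R ^ 2 / 2) R (1/2) (-1 / (3 * R)) R x using 1
      · ext y; field_simp; ring
      · field_simp; ring
    · refine hasDerivAt_glue (c := 4 * R)
        (f' := fun r => R - (r - 2 * R) + (r - 2 * R) ^ 2 / (4 * R)) (g' := fun r => 0)
        ?_ ?_ ?_ ?_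
      · intro x
        convert hp (5 * R ^ 2 / 3) R (-1/2) (1 / (12 * R)) (2 * R) x using 1
        · ext y; field_simp; ring
        · field_simp; ring
      · intro x
        exact hasDerivAt_const x _
      · field_simp; ring
      · field_simp; ring
    · rw [if_pos (by linarith)]
      field_simp; ring
    · rw [if_pos (by linarith)]
      field_simp; ring
  · rw [if_pos (by linarith)]
    field_simp; ring
  · rw [if_pos (by linarith)]
    field_simp; ring

lemma continuous_dtau {R : ℝ} (hR : 0 < R) : Continuous (dtau R) := by
  unfold dtau
  refine Continuous.if_le (by fun_prop) (Continuous.if_le (by fun_prop) (Continuous.if_le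
    (by fun_prop) (by fun_prop) (by fun_prop) (by fun_prop) ?_)
    (by fun_prop) (by fun_prop) ?_) (by fun_prop) (by fun_prop) ?_
  · rintro x rfl
    field_simp; ring
  · rintro x rfl
    rw [if_pos (by linarith)]
    field_simp; ring
  · rintro x rfl
    rw [if_pos (by linarith)]
    field_simp; ring

lemma dtau_nonneg {R r : ℝ} (hR : 0 < R) (hr : 0 ≤ r) : 0 ≤ dtau R r := by
  unfold dtau
  split_ifs with h1 h2 h3
  · exact hr
  · push Not at h1
    have : R + (r - R) - (r - R) ^ 2 / R = (R * r - (r - R) ^ 2) / R := by field_simp; ring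
    rw [this]
    apply div_nonneg _ hR.le
    nlinarith
  · have : R - (r - 2 * R) + (r - 2 * R) ^ 2 / (4 * R) = (r - 4 * R) ^ 2 / (4 * R) := by
      field_simp; ring
    rw [this]; positivity
  · exact le_rfl

lemma dtau_le {R r : ℝ} (hR : 0 < R) : dtau R r ≤ 5 * R / 4 := by
  unfold dtau
  split_ifs with h1 h2 h3
  · linarith
  · have : 5 * R / 4 - (R + (r - R) - (r - R) ^ 2 / R) = (r - R - R / 2) ^ 2 / R := by
      field_simp; ring
    have h : 0 ≤ (r - R - R / 2) ^ 2 / R := by positivity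
    linarith
  · have : R - (r - 2 * R) + (r - 2 * R) ^ 2 / (4 * R) = (r - 4 * R) ^ 2 / (4 * R) := by
      field_simp; ring
    rw [this, div_le_iff₀ (by positivity)]
    push Not at h2
    nlinarith
  · positivity

lemma continuous_muf {R : ℝ} (hR : 0 < R) : Continuous (muf R) := by
  unfold muf
  refine Continuous.if_le (by fun_prop) (Continuous.if_le
    (by fun_prop) (by fun_prop) (by fun_prop) (by fun_prop) ?_)
    (by fun_prop) (by fun_prop) ?_
  · rintro x rfl
    have : Real.pi * (4 * R - R) / (3 * R) = Real.pi := by field_simp; ring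
    rw [this]; simp
  · rintro x rfl
    rw [if_pos (by linarith)]
    norm_num

lemma muf_nonneg (R r : ℝ) : 0 ≤ muf R r := by
  unfold muf
  split_ifs
  · norm_num
  · linarith [Real.neg_one_le_cos (Real.pi * (r - R) / (3 * R))]
  · exact le_rfl

lemma muf_le_one (R r : ℝ) : muf R r ≤ 1 := by
  unfold muf
  split_ifs
  · norm_num
  · linarith [Real.cos_le_one (Real.pi * (r - R) / (3 * R))]
  · norm_num

lemma hasDerivAt_psi {R : ℝ} (α : ℝ) (hR : 0 < R) (r : ℝ) :
    HasDerivAt (psi α R) (-(α * dtau R r) * psi α R r) r := by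
  have := (((hasDerivAt_tau hR r).const_mul α).neg).exp
  rw [mul_comm]
  exact this

lemma continuous_psi {R : ℝ} (α : ℝ) (hR : 0 < R) : Continuous (psi α R) :=
  continuous_iff_continuousAt.2 fun r => (hasDerivAt_psi α hR r).continuousAt

lemma psi_pos (α R r : ℝ) : 0 < psi α R r := Real.exp_pos _

lemma psi_anti {α R : ℝ} (hα : 0 < α) (hR : 0 < R) : AntitoneOn (psi α R) (Set.Ici 0) := by
  refine antitoneOn_of_deriv_nonpos (convex_Ici 0) (continuous_psi α hR).continuousOn
    (fun x _ => (hasDerivAt_psi α hR x).differentiableAt.differentiableWithinAt) ?_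
  intro x hx
  rw [interior_Ici] at hx
  rw [(hasDerivAt_psi α hR x).deriv]
  have h1 := dtau_nonneg hR (le_of_lt hx)
  have h2 := (psi_pos α R x).le
  have : 0 ≤ α * dtau R x * psi α R x := by positivity
  linarith

lemma psi_le_one {α R r : ℝ} (hα : 0 < α) (hR : 0 < R) (hr : 0 ≤ r) : psi α R r ≤ 1 := by
  have := psi_anti hα hR Set.self_mem_Ici hr hr
  refine this.trans_eq ?_
  simp [psi, tau, hR.le]

lemma hasDerivAt_PsiInt {R : ℝ} (α : ℝ) (hR : 0 < R) (r : ℝ) :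
    HasDerivAt (PsiInt α R) (psi α R r) r :=
  (continuous_psi α hR).integral_hasStrictDerivAt 0 r |>.hasDerivAt

lemma continuous_PsiInt {R : ℝ} (α : ℝ) (hR : 0 < R) : Continuous (PsiInt α R) :=
  continuous_iff_continuousAt.2 fun r => (hasDerivAt_PsiInt α hR r).continuousAt

lemma PsiInt_nonneg {α R r : ℝ} (hr : 0 ≤ r) : 0 ≤ PsiInt α R r :=
  intervalIntegral.integral_nonneg hr fun s _ => (psi_pos α R s).le

lemma PsiInt_sub {α R a b : ℝ} (hR : 0 < R) :
    PsiInt α R b - PsiInt α R a = ∫ s in a..b, psi α R s :=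
  intervalIntegral.integral_interval_sub_left
    ((continuous_psi α hR).intervalIntegrable _ _) ((continuous_psi α hR).intervalIntegrable _ _)

lemma PsiInt_mono {α R a b : ℝ} (hR : 0 < R) (h : a ≤ b) : PsiInt α R a ≤ PsiInt α R b := by
  have h1 := PsiInt_sub (α := α) (a := a) (b := b) hR
  have h2 : 0 ≤ ∫ s in a..b, psi α R s :=
    intervalIntegral.integral_nonneg h fun s _ => (psi_pos α R s).le
  linarith

lemma PsiInt_concave {α R s b : ℝ} (hα : 0 < α) (hR : 0 < R) (hs : 0 ≤ s) (hb : s ≤ b) :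
    s * PsiInt α R b ≤ b * PsiInt α R s := by
  have h1 := PsiInt_sub (α := α) (a := s) (b := b) hR
  have h2 : ∫ t in s..b, psi α R t ≤ ∫ t in s..b, psi α R s := by
    refine intervalIntegral.integral_mono_on hb ((continuous_psi α hR).intervalIntegrable _ _)
      (by simp) ?_
    intro t ht
    exact psi_anti hα hR hs (hs.trans ht.1) ht.1
  have h3 : ∫ t in (0:ℝ)..s, psi α R s ≤ PsiInt α R s := by
    refine intervalIntegral.integral_mono_on hs (by simp)
      ((continuous_psi α hR).intervalIntegrable _ _) ?_
    intro t ht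
    exact psi_anti hα hR ht.1 hs ht.2
  simp only [intervalIntegral.integral_const, smul_eq_mul] at h2 h3
  have h4 := mul_le_mul_of_nonneg_left h2 hs
  have h5 := mul_le_mul_of_nonneg_left h3 (sub_nonneg.2 hb)
  rw [← h1] at h4
  nlinarith

/-- The integrand of ν. -/
noncomputable def phi (α R s : ℝ) : ℝ := muf R s * PsiInt α R s / psi α R s

lemma continuous_phi {R : ℝ} (α : ℝ) (hR : 0 < R) : Continuous (phi α R) :=
  ((continuous_muf hR).mul (continuous_PsiInt α hR)).div (continuous_psi α hR)
    fun s => (psi_pos α R s).ne'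

lemma phi_nonneg {α R s : ℝ} (hs : 0 ≤ s) : 0 ≤ phi α R s :=
  div_nonneg (mul_nonneg (muf_nonneg R s) (PsiInt_nonneg hs)) (psi_pos α R s).le

/-- The normalising constant of ν. -/
noncomputable def Dc (α R : ℝ) : ℝ := ∫ s in (0:ℝ)..(4 * R), phi α R s

lemma Dc_ge {α R : ℝ} (hα : 0 < α) (hR : 0 < R) : R / 8 * PsiInt α R (4 * R) ≤ Dc α R := by
  have hi : ∀ a b, IntervalIntegrable (phi α R) volume a b :=
    fun a b => (continuous_phi α hR).intervalIntegrable a b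
  have h1 : Dc α R = (∫ s in (0:ℝ)..R, phi α R s) + ∫ s in R..(4 * R), phi α R s :=
    (intervalIntegral.integral_add_adjacent_intervals (hi _ _) (hi _ _)).symm
  have h2 : 0 ≤ ∫ s in R..(4 * R), phi α R s :=
    intervalIntegral.integral_nonneg (by linarith) fun s hs => phi_nonneg (hR.le.trans hs.1)
  have h3 : ∫ s in (0:ℝ)..R, s * (PsiInt α R (4 * R) / (4 * R)) ≤ ∫ s in (0:ℝ)..R, phi α R s := by
    refine intervalIntegral.integral_mono_on hR.le
      (Continuous.intervalIntegrable (by fun_prop) _ _) (hi _ _) ?_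
    intro s hs
    have e1 := PsiInt_concave hα hR hs.1 (show s ≤ 4 * R by linarith [hs.2])
    have e2 : phi α R s = PsiInt α R s / psi α R s := by simp [phi, muf, hs.2]
    have e3 : PsiInt α R s ≤ PsiInt α R s / psi α R s :=
      le_div_self (PsiInt_nonneg hs.1) (psi_pos α R s) (psi_le_one hα hR hs.1)
    rw [e2]
    refine le_trans ?_ e3
    rw [← mul_div_assoc, div_le_iff₀ (by positivity)]
    linarith
  rw [intervalIntegral.integral_mul_const, integral_id] at h3
  have e : (R ^ 2 - 0 ^ 2) / 2 * (PsiInt α R (4 * R) / (4 * R)) = R / 8 * PsiInt α R (4 * R) := by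
    field_simp; ring
  linarith

lemma PsiInt_pos {α R : ℝ} (hα : 0 < α) (hR : 0 < R) : 0 < PsiInt α R (4 * R) :=
  intervalIntegral.intervalIntegral_pos_of_pos ((continuous_psi α hR).intervalIntegrable _ _)
    (fun s => psi_pos α R s) (by linarith)

lemma Dc_pos {α R : ℝ} (hα : 0 < α) (hR : 0 < R) : 0 < Dc α R := by
  have := Dc_ge hα hR
  have h := PsiInt_pos hα hR
  have : 0 < R / 8 * PsiInt α R (4 * R) := by positivity
  linarith

lemma muf_zero {R r : ℝ} (hR : 0 < R) (h : 4 * R ≤ r) : muf R r = 0 := by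
  have h1 : ¬ r ≤ R := by linarith
  rcases eq_or_lt_of_le h with e | e
  · subst e
    have : Real.pi * (4 * R - R) / (3 * R) = Real.pi := by field_simp; ring
    simp only [muf, h1, if_false, le_refl, if_true, this]
    simp
  · simp [muf, h1, not_le.2 e]

lemma int_le_Dc {α R r : ℝ} (hR : 0 < R) (hr : 0 ≤ r) :
    ∫ s in (0:ℝ)..r, phi α R s ≤ Dc α R := by
  have hi : ∀ a b, IntervalIntegrable (phi α R) volume a b :=
    fun a b => (continuous_phi α hR).intervalIntegrable a b
  have h1 : (∫ s in (0:ℝ)..r, phi α R s) + ∫ s in r..(4 * R), phi α R s = Dc α R :=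
    intervalIntegral.integral_add_adjacent_intervals (hi _ _) (hi _ _)
  rcases le_total r (4 * R) with h | h
  · have : 0 ≤ ∫ s in r..(4 * R), phi α R s :=
      intervalIntegral.integral_nonneg h fun s hs => phi_nonneg (hr.trans hs.1)
    linarith
  · have : ∫ s in r..(4 * R), phi α R s = 0 := by
      rw [intervalIntegral.integral_congr (g := fun _ => (0:ℝ))]
      · simp
      · intro s hs
        rw [Set.uIcc_of_ge h] at hs
        simp [phi, muf_zero hR hs.1]
    linarith

lemma nuf_eq (α R r : ℝ) :
    nuf α R r = 1 - (1 / 2) * (∫ s in (0:ℝ)..r, phi α R s) / Dc α R := rfl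

lemma hasDerivAt_nuf {R : ℝ} (α : ℝ) (hR : 0 < R) (r : ℝ) :
    HasDerivAt (nuf α R) (-((1 / 2) * phi α R r / Dc α R)) r := by
  have h : HasDerivAt (fun r => ∫ s in (0:ℝ)..r, phi α R s) (phi α R r) r :=
    (continuous_phi α hR).integral_hasStrictDerivAt 0 r |>.hasDerivAt
  exact ((h.const_mul (1 / 2)).div_const (Dc α R)).const_sub 1

lemma continuous_nuf {R : ℝ} (α : ℝ) (hR : 0 < R) : Continuous (nuf α R) :=
  continuous_iff_continuousAt.2 fun r => (hasDerivAt_nuf α hR r).continuousAt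

lemma nuf_le_one {α R r : ℝ} (hα : 0 < α) (hR : 0 < R) (hr : 0 ≤ r) : nuf α R r ≤ 1 := by
  have h1 : 0 ≤ ∫ s in (0:ℝ)..r, phi α R s :=
    intervalIntegral.integral_nonneg hr fun s hs => phi_nonneg hs.1
  have h2 := Dc_pos hα hR
  have : 0 ≤ (1 / 2) * (∫ s in (0:ℝ)..r, phi α R s) / Dc α R := by positivity
  rw [nuf_eq]; linarith

lemma nuf_nonneg {α R r : ℝ} (hα : 0 < α) (hR : 0 < R) (hr : 0 ≤ r) : 0 ≤ nuf α R r := by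
  have h1 := int_le_Dc (α := α) hR hr
  have h2 := Dc_pos hα hR
  have : (1 / 2) * (∫ s in (0:ℝ)..r, phi α R s) / Dc α R ≤ 1 := by
    rw [div_le_one h2]; linarith
  rw [nuf_eq]; linarith

lemma deriv_qf {R : ℝ} (α : ℝ) (hR : 0 < R) (r : ℝ) :
    HasDerivAt (qf α R) (psi α R r * nuf α R r) r :=
  ((continuous_psi α hR).mul (continuous_nuf α hR)).integral_hasStrictDerivAt 0 r |>.hasDerivAt

lemma deriv2_qf {R : ℝ} (α : ℝ) (hR : 0 < R) (r : ℝ) :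
    HasDerivAt (fun r => psi α R r * nuf α R r)
      (-(α * dtau R r * psi α R r * nuf α R r + (1 / 2) * (muf R r * PsiInt α R r) / Dc α R)) r := by
  refine HasDerivAt.congr_deriv (f := fun r => psi α R r * nuf α R r)
    ((hasDerivAt_psi α hR r).mul (hasDerivAt_nuf α hR r)) ?_
  have := (psi_pos α R r).ne'
  unfold phi
  field_simp
  ring

theorem q_second_deriv_bounds (α R : ℝ) (hα : 0 < α) (hR : 0 < R) :
    ContDiffOn ℝ 2 (qf α R) (Set.Ici 0) ∧
    ∀ r : ℝ, 0 ≤ r →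
      deriv (deriv (qf α R)) r ≤ 0 ∧
      |deriv (deriv (qf α R)) r| ≤ 5 * α * R / 4 + 4 / R := by
  have d1 : deriv (qf α R) = fun r => psi α R r * nuf α R r :=
    funext fun r => (deriv_qf α hR r).deriv
  have d2 : deriv (deriv (qf α R)) = fun r => -(α * dtau R r * psi α R r * nuf α R r +
      (1 / 2) * (muf R r * PsiInt α R r) / Dc α R) := by
    rw [d1]; exact funext fun r => (deriv2_qf α hR r).deriv
  constructor
  · refine ContDiff.contDiffOn ?_
    rw [show (2 : WithTop ℕ∞) = 1 + 1 by norm_num, contDiff_succ_iff_deriv]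
    refine ⟨fun r => (deriv_qf α hR r).differentiableAt, by simp, ?_⟩
    rw [contDiff_one_iff_deriv, d2]
    refine ⟨by rw [d1]; exact fun r => (deriv2_qf α hR r).differentiableAt, ?_⟩
    have c1 := continuous_dtau hR
    have c2 := continuous_psi α hR
    have c3 := continuous_nuf α hR
    have c4 := continuous_muf hR
    have c5 := continuous_PsiInt α hR
    fun_prop
  · intro r hr
    rw [d2]
    simp only
    have p1 := dtau_nonneg hR hr
    have p2 := (psi_pos α R r).le
    have p3 := nuf_nonneg hα hR hr
    have p4 := muf_nonneg R r
    have p5 : 0 ≤ PsiInt α R r := PsiInt_nonneg hr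
    have p6 := Dc_pos hα hR
    have a1 : 0 ≤ α * dtau R r * psi α R r * nuf α R r := by positivity
    have a2 : 0 ≤ (1 / 2) * (muf R r * PsiInt α R r) / Dc α R := by positivity
    refine ⟨by linarith, ?_⟩
    rw [abs_neg, abs_of_nonneg (by linarith)]
    have b1 : α * dtau R r * psi α R r * nuf α R r ≤ 5 * α * R / 4 := by
      calc α * dtau R r * psi α R r * nuf α R r
          ≤ α * (5 * R / 4) * 1 * 1 := by
            gcongr
            · exact dtau_le hR
            · exact psi_le_one hα hR hr
            · exact nuf_le_one hα hR hr
        _ = _ := by ring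
    have b2 : (1 / 2) * (muf R r * PsiInt α R r) / Dc α R ≤ 4 / R := by
      have hm : muf R r * PsiInt α R r ≤ PsiInt α R (4 * R) := by
        rcases le_total r (4 * R) with h | h
        · have := PsiInt_mono (α := α) hR h
          have := mul_le_mul_of_nonneg_right (muf_le_one R r) p5
          linarith
        · rw [muf_zero hR h, zero_mul]
          exact (PsiInt_pos hα hR).le
      have hD := Dc_ge hα hR
      rw [div_le_div_iff₀ p6 hR]
      nlinarith
    linarith
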